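/- Let k be a field, A a finite-dimensional k-algebra, R ∈ A⊗A an invertible solution of the pentagon equation, and m = l(R). Then there exists an injective map of unital algebras M_m(k) → A; consequently A is isomorphic as a k-algebra to M_m(B), where B is the centralizer in A of the image of M_m(k), and in particular l(R)² divides dim_k(A). -/

import Mathlib

open TensorProduct

set_option maxHeartbeats 1000000
set_option synthInstance.maxHeartbeats 200000

namespace PentagonPaper

section Pentagon

variable (k : Type*) [Field k] (A : Type*) [Ring A] [Algebra k A]

/-- `x ⊗ y ↦ x ⊗ y ⊗ 1` -/
noncomputable def leg12 : A ⊗[k] A →ₐ[k] A ⊗[k] (A ⊗[k] A) :=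
  Algebra.TensorProduct.map (AlgHom.id k A) Algebra.TensorProduct.includeLeft

/-- `x ⊗ y ↦ x ⊗ 1 ⊗ y` -/
noncomputable def leg13 : A ⊗[k] A →ₐ[k] A ⊗[k] (A ⊗[k] A) :=
  Algebra.TensorProduct.map (AlgHom.id k A) Algebra.TensorProduct.includeRight

/-- `x ⊗ y ↦ 1 ⊗ x ⊗ y` -/
noncomputable def leg23 : A ⊗[k] A →ₐ[k] A ⊗[k] (A ⊗[k] A) :=
  Algebra.TensorProduct.includeRight

variable {k A}

/-- The pentagon equation `R¹²R¹³R²³ = R²³R¹²`. -/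
def IsPentagon (R : A ⊗[k] A) : Prop :=
  leg12 k A R * leg13 k A R * leg23 k A R = leg23 k A R * leg12 k A R

/-- `φ ↦ (id ⊗ φ)(R)`, i.e. the map sending a functional to the corresponding
left coefficient of `R`. -/
noncomputable def lCoefMap (R : A ⊗[k] A) : Module.Dual k A →ₗ[k] A :=
  (TensorProduct.rid k A).toLinearMap ∘ₗ LinearMap.applyₗ R ∘ₗ LinearMap.lTensorHom A

/-- `φ ↦ (φ ⊗ id)(R)`, i.e. the map sending a functional to the corresponding
right coefficient of `R`. -/
noncomputable def rCoefMap (R : A ⊗[k] A) : Module.Dual k A →ₗ[k] A :=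
  (TensorProduct.lid k A).toLinearMap ∘ₗ LinearMap.applyₗ R ∘ₗ LinearMap.rTensorHom A

/-- The space `R_(l)` of left coefficients of `R`. -/
noncomputable def lCoefs (R : A ⊗[k] A) : Submodule k A := LinearMap.range (lCoefMap R)

/-- The space `R_(r)` of right coefficients of `R`. -/
noncomputable def rCoefs (R : A ⊗[k] A) : Submodule k A := LinearMap.range (rCoefMap R)

/-- `R` is unitary if `1 ∈ R_(l) ∩ R_(r)`. -/
def IsUnitary (R : A ⊗[k] A) : Prop := (1 : A) ∈ lCoefs R ∧ (1 : A) ∈ rCoefs R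

/-- The length `l(R)`: the minimal `m` such that `R = ∑_{i=1}^m aᵢ ⊗ bᵢ`. -/
noncomputable def length (R : A ⊗[k] A) : ℕ :=
  sInf {m : ℕ | ∃ a b : Fin m → A, R = ∑ i, a i ⊗ₜ[k] b i}

/-- The left `R`-coinvariants `A^{R,l} = {a | R(a ⊗ 1) = a ⊗ 1}`. -/
noncomputable def lCoinv (R : A ⊗[k] A) : Submodule k A where
  carrier := {a : A | R * (a ⊗ₜ[k] (1 : A)) = a ⊗ₜ[k] (1 : A)}
  add_mem' := by
    intro a b ha hb
    simp only [Set.mem_setOf_eq, TensorProduct.add_tmul, mul_add] at *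
    rw [ha, hb]
  zero_mem' := by simp
  smul_mem' := by
    intro c a ha
    simp only [Set.mem_setOf_eq] at *
    rw [← TensorProduct.smul_tmul', mul_smul_comm, ha]

/-- The right `R`-coinvariants `A^{R,r} = {a | (1 ⊗ a)R = 1 ⊗ a}`. -/
noncomputable def rCoinv (R : A ⊗[k] A) : Submodule k A where
  carrier := {a : A | ((1 : A) ⊗ₜ[k] a) * R = (1 : A) ⊗ₜ[k] a}
  add_mem' := by
    intro a b ha hb
    simp only [Set.mem_setOf_eq, TensorProduct.tmul_add, add_mul] at *
    rw [ha, hb]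
  zero_mem' := by simp
  smul_mem' := by
    intro c a ha
    simp only [Set.mem_setOf_eq, TensorProduct.tmul_smul, smul_mul_assoc] at *
    rw [ha]

/-- The comultiplication `Δ_r : a ↦ R⁻¹(1 ⊗ a)R` on `A`. -/
noncomputable def deltaR (R : A ⊗[k] A) : A →ₗ[k] A ⊗[k] A where
  toFun a := Ring.inverse R * ((1 : A) ⊗ₜ[k] a) * R
  map_add' a b := by simp [TensorProduct.tmul_add, mul_add, add_mul]
  map_smul' c a := by simp [TensorProduct.tmul_smul, mul_smul_comm, smul_mul_assoc]

/-- The comultiplication `Δ_l : a ↦ R(a ⊗ 1)R⁻¹` on `A`. -/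
noncomputable def deltaL (R : A ⊗[k] A) : A →ₗ[k] A ⊗[k] A where
  toFun a := R * (a ⊗ₜ[k] (1 : A)) * Ring.inverse R
  map_add' a b := by simp [TensorProduct.add_tmul, mul_add, add_mul]
  map_smul' c a := by
    simp only [RingHom.id_apply]
    rw [← TensorProduct.smul_tmul', mul_smul_comm, smul_mul_assoc]

end Pentagon

section MatrixUnits

variable {k : Type*} [Field k] {A : Type*} [Ring A] [Algebra k A] {n : ℕ}

/-- The product of two elements written in terms of matrix units. -/
theorem sum_mul_sum_matrixUnits (e X Y : Fin n → Fin n → A)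
    (hmul : ∀ i j p q, e i j * e p q = if j = p then e i q else 0)
    (hcomm : ∀ i j p q, e i j * Y p q = Y p q * e i j) :
    (∑ i, ∑ j, X i j * e i j) * (∑ i, ∑ j, Y i j * e i j)
      = ∑ i, ∑ j, (∑ p, X i p * Y p j) * e i j := by
  have h : ∀ i j p q, X i j * e i j * (Y p q * e p q)
      = if j = p then X i j * Y p q * e i q else 0 := by
    intro i j p q
    rw [mul_assoc, ← mul_assoc (e i j), hcomm, mul_assoc (Y p q), hmul]
    split_ifs <;> simp [mul_assoc]
  simp_rw [Finset.sum_mul, Finset.mul_sum, h]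
  refine Finset.sum_congr rfl fun i _ => ?_
  rw [Finset.sum_comm (s := Finset.univ (α := Fin n)) (f := fun j p => X i p * Y p j * e i j)]
  simp

/-- A full system of matrix units in an algebra is the image of the standard one under an
algebra homomorphism. -/
theorem exists_algHom_of_matrixUnits (e : Fin n → Fin n → A)
    (hmul : ∀ i j p q, e i j * e p q = if j = p then e i q else 0) (hone : ∑ i, e i i = 1) :
    ∃ F : Matrix (Fin n) (Fin n) k →ₐ[k] A, ∀ i j, F (Matrix.single i j 1) = e i j := by
  refine ⟨AlgHom.ofLinearMap
    { toFun := fun M => ∑ i, ∑ j, M i j • e i j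
      map_add' := fun M N => by simp [add_smul, Finset.sum_add_distrib]
      map_smul' := fun c M => by simp [Finset.smul_sum, mul_smul] } ?_ ?_, fun i j => ?_⟩
  · simp [Matrix.one_apply, ite_smul, hone]
  · intro M N
    have h := sum_mul_sum_matrixUnits e (fun i j => algebraMap k A (M i j))
      (fun i j => algebraMap k A (N i j)) hmul (fun i j p q => (Algebra.commutes _ _).symm)
    simp only [← map_mul, ← map_sum, ← Algebra.smul_def] at h
    simpa [Matrix.mul_apply] using h.symm
  · simp [Matrix.single_apply, ite_and, ite_smul]

/-- An algebra containing the matrix algebra `M_n(k)` is the algebra of `n × n` matrices over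
the centralizer of `M_n(k)`. -/
theorem nonempty_algEquiv_matrix_centralizer (F : Matrix (Fin n) (Fin n) k →ₐ[k] A) :
    Nonempty (A ≃ₐ[k] Matrix (Fin n) (Fin n) ↥(Subalgebra.centralizer k (Set.range F))) := by
  set e : Fin n → Fin n → A := fun i j => F (Matrix.single i j 1) with he
  have hmul : ∀ i j p q, e i j * e p q = if j = p then e i q else 0 := by
    intro i j p q
    split_ifs with h
    · subst h
      simp [he, ← map_mul]
    · simp only [he]
      rw [← map_mul, Matrix.single_mul_single_of_ne (h := h), map_zero]
  have hone : ∑ i, e i i = 1 := by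
    simp only [he]
    rw [← map_sum, Matrix.sum_single_one, map_one]
  have hcomm : ∀ (c : ↥(Subalgebra.centralizer k (Set.range F))) i j,
      e i j * (c : A) = c * e i j := fun c i j =>
    (Subalgebra.mem_centralizer_iff k).1 c.2 _ ⟨_, rfl⟩
  have hFe : ∀ M, F M = ∑ i, ∑ j, M i j • e i j := by
    intro M
    conv_lhs => rw [Matrix.matrix_eq_sum_single M]
    simp only [map_sum, he, ← map_smul, Matrix.smul_single, smul_eq_mul, mul_one]
  let G : Matrix (Fin n) (Fin n) ↥(Subalgebra.centralizer k (Set.range F)) →ₐ[k] A :=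
    AlgHom.ofLinearMap
      { toFun := fun M => ∑ i, ∑ j, (M i j : A) * e i j
        map_add' := fun M N => by simp [add_mul, Finset.sum_add_distrib]
        map_smul' := fun c M => by simp [Finset.smul_sum] }
      (by
        have : ∀ i j, ((((1 : Matrix (Fin n) (Fin n)
            ↥(Subalgebra.centralizer k (Set.range F))) i j : _) : A)) = if i = j then 1 else 0 := by
          intro i j
          rw [Matrix.one_apply]
          split_ifs <;> simp
        simp [this, hone])
      (by
        intro M N
        have h := sum_mul_sum_matrixUnits e (fun i j => (M i j : A)) (fun i j => (N i j : A)) hmul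
          (fun i j p q => hcomm _ _ _)
        simpa [Matrix.mul_apply] using h.symm)
  have hG : ∀ M, G M = ∑ i, ∑ j, (M i j : A) * e i j := fun M => rfl
  refine ⟨(AlgEquiv.ofBijective G ⟨?_, ?_⟩).symm⟩
  · have key : ∀ M p q, ∑ r, e r p * G M * e q r = (M p q : A) := by
      intro M p q
      have : ∀ r i j, e r p * ((M i j : A) * e i j) * e q r
          = if p = i then if j = q then (M i j : A) * e r r else 0 else 0 := by
        intro r i j
        rw [← mul_assoc, hcomm, mul_assoc, mul_assoc, ← mul_assoc (e r p), hmul]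
        by_cases h1 : p = i <;> by_cases h2 : j = q <;> simp [hmul, h1, h2]
      simp only [hG, Finset.mul_sum, Finset.sum_mul, this]
      simp [← Finset.mul_sum, hone]
    intro M N h
    ext p q
    rw [← key M, ← key N, h]
  · intro a
    have hcen : ∀ i j, (∑ p, e p i * a * e j p) ∈ Subalgebra.centralizer k (Set.range F) := by
      intro i j
      rw [Subalgebra.mem_centralizer_iff]
      rintro _ ⟨M, rfl⟩
      have h1 : ∀ x y, e x y * (∑ p, e p i * a * e j p) = (∑ p, e p i * a * e j p) * e x y := by
        intro x y
        simp [Finset.mul_sum, Finset.sum_mul, ← mul_assoc, hmul]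
        simp [mul_assoc, hmul]
      rw [hFe]
      simp only [Finset.sum_mul _ (fun i => ∑ j, M i j • e i j),
        Finset.sum_mul _ (fun j => M _ j • e _ j),
        Finset.mul_sum _ (fun i => ∑ j, M i j • e i j),
        Finset.mul_sum _ (fun j => M _ j • e _ j), smul_mul_assoc, mul_smul_comm, h1]
    refine ⟨Matrix.of fun i j => ⟨_, hcen i j⟩, ?_⟩
    rw [hG]
    simp only [Matrix.of_apply, Finset.sum_mul, mul_assoc, hmul]
    calc _ = ∑ i, ∑ j, e i i * (a * e j j) := by simp
      _ = a := by
        simp only [← Finset.mul_sum, ← Finset.sum_mul, hone, one_mul, mul_one]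

end MatrixUnits

section TensorRank

variable {k : Type*} [Field k] {A : Type*} [Ring A] [Algebra k A] {m : ℕ}

/-- A linearly independent family admits a dual family of functionals. -/
theorem exists_dual_family {V : Type*} [AddCommGroup V] [Module k V] {a : Fin m → V}
    (ha : LinearIndependent k a) :
    ∃ φ : Fin m → Module.Dual k V, ∀ i j, φ i (a j) = if i = j then 1 else 0 := by
  obtain ⟨g, hg⟩ := LinearMap.exists_extend (p := Submodule.span k (Set.range a)) ha.repr
  refine ⟨fun i => Finsupp.lapply i ∘ₗ g, fun i j => ?_⟩
  have h := LinearMap.congr_fun hg ⟨a j, Submodule.subset_span ⟨j, rfl⟩⟩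
  simp only [LinearMap.comp_apply, Submodule.subtype_apply] at h
  rw [LinearMap.comp_apply, h, ha.repr_eq_single j _ rfl, Finsupp.lapply_apply,
    Finsupp.single_apply]
  simp [eq_comm]

/-- Coefficients with respect to a linearly independent family of left factors are unique. -/
theorem eq_of_sum_tmul_eq {V M : Type*} [AddCommGroup V] [Module k V] [AddCommGroup M]
    [Module k M] {a : Fin m → V} {φ : Fin m → Module.Dual k V}
    (hφ : ∀ i j, φ i (a j) = if i = j then 1 else 0) {x y : Fin m → M}
    (h : ∑ i, a i ⊗ₜ[k] x i = ∑ i, a i ⊗ₜ[k] y i) (i : Fin m) : x i = y i := by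
  have h' := congrArg (fun t => TensorProduct.lid k M ((φ i).rTensor M t)) h
  simpa [hφ, ite_smul] using h'

/-- In a finite-dimensional algebra, left multiplication by a unit `r` that preserves a subspace
is onto that subspace. -/
theorem exists_mul_eq_of_isUnit {B : Type*} [Ring B] [Algebra k B] [FiniteDimensional k B]
    {r : B} (hr : IsUnit r) {N : Submodule k B} (hN : ∀ x ∈ N, r * x ∈ N) {y : B} (hy : y ∈ N) :
    ∃ x ∈ N, r * x = y := by
  have hinj : Function.Injective ((LinearMap.mulLeft k r).restrict hN) := by
    intro x x' h
    have h' : r * (x : B) = r * (x' : B) := congrArg Subtype.val h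
    exact Subtype.ext (hr.mul_left_cancel h')
  obtain ⟨x, hx⟩ := LinearMap.injective_iff_surjective.1 hinj ⟨y, hy⟩
  exact ⟨x, x.2, congrArg Subtype.val hx⟩

/-- If `∑ aᵢ ⊗ bᵢ` has the shortest possible length among its decompositions, the left factors
are linearly independent. -/
theorem linearIndependent_of_shortest {V W : Type*} [AddCommGroup V] [Module k V]
    [AddCommGroup W] [Module k W] {a : Fin m → V} {b : Fin m → W}
    (hmin : ∀ (r : ℕ) (a' : Fin r → V) (b' : Fin r → W),
      ∑ i, a i ⊗ₜ[k] b i = ∑ i, a' i ⊗ₜ[k] b' i → m ≤ r) :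
    LinearIndependent k a := by
  rw [linearIndependent_iff_card_le_finrank_span, Fintype.card_fin]
  have : Module.Finite k (Submodule.span k (Set.range a)) :=
    FiniteDimensional.span_of_finite k (Set.finite_range a)
  let e := Module.finBasis k (Submodule.span k (Set.range a))
  let v : Fin m → Submodule.span k (Set.range a) := fun i =>
    ⟨a i, Submodule.subset_span ⟨i, rfl⟩⟩
  refine hmin _ (fun j => (e j : V)) (fun j => ∑ i, e.repr (v i) j • b i) ?_
  have h : ∀ i, a i = ∑ j, e.repr (v i) j • (e j : V) := by
    intro i
    have := congrArg (Submodule.subtype _) (e.sum_repr (v i))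
    simp only [map_sum, map_smul, Submodule.subtype_apply] at this
    exact this.symm
  simp only [TensorProduct.tmul_sum, TensorProduct.tmul_smul]
  rw [Finset.sum_comm]
  refine Finset.sum_congr rfl fun i _ => ?_
  conv_lhs => rw [h i]
  simp only [TensorProduct.sum_tmul, TensorProduct.smul_tmul']
  rfl

/-- A tensor is a sum of `length R` pure tensors, with linearly independent factors. -/
theorem exists_decomposition (R : A ⊗[k] A) :
    ∃ a b : Fin (length R) → A, R = ∑ i, a i ⊗ₜ[k] b i ∧
      LinearIndependent k a ∧ LinearIndependent k b := by
  have hne : {m : ℕ | ∃ a b : Fin m → A, R = ∑ i, a i ⊗ₜ[k] b i}.Nonempty := by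
    obtain ⟨S, hS⟩ := TensorProduct.exists_finset R
    refine ⟨S.card, fun i => (S.equivFin.symm i).1.1, fun i => (S.equivFin.symm i).1.2, ?_⟩
    rw [hS, ← Finset.sum_coe_sort, ← S.equivFin.symm.sum_comp]
  obtain ⟨a, b, hR⟩ := Nat.sInf_mem hne
  refine ⟨a, b, hR, linearIndependent_of_shortest (b := b) fun r a' b' h => ?_,
    linearIndependent_of_shortest (b := a) fun r b' a' h => ?_⟩
  · exact Nat.sInf_le ⟨a', b', hR.trans h⟩
  · refine Nat.sInf_le ⟨a', b', hR.trans ?_⟩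
    have h' := congrArg (TensorProduct.comm k A A) h
    simpa using h'

end TensorRank

section StructureConstants

variable {k : Type*} [Field k] {A : Type*} [Ring A] [Algebra k A] {m : ℕ}

theorem sum_rotate {M : Type*} [AddCommMonoid M] (f : Fin m → Fin m → Fin m → M) :
    ∑ i, ∑ j, ∑ t, f i j t = ∑ t, ∑ i, ∑ j, f i j t := by
  rw [Finset.sum_comm (f := fun t i => ∑ j, f i j t)]
  exact Finset.sum_congr rfl fun i _ => Finset.sum_comm

theorem leg12_tmul (x y : A) : leg12 k A (x ⊗ₜ y) = x ⊗ₜ (y ⊗ₜ 1) := by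
  simp [leg12]

theorem leg13_tmul (x y : A) : leg13 k A (x ⊗ₜ y) = x ⊗ₜ (1 ⊗ₜ y) := by
  simp [leg13]

theorem leg23_apply (x : A ⊗[k] A) : leg23 k A x = 1 ⊗ₜ x := rfl

theorem leg12_eq_assoc (x : A ⊗[k] A) :
    leg12 k A x = Algebra.TensorProduct.assoc k k k A A A (x ⊗ₜ 1) := by
  induction x with
  | zero => simp
  | tmul x y => simp [leg12_tmul]
  | add x y hx hy => simp only [map_add, hx, hy, TensorProduct.add_tmul]

/-- Conjugation of `leg12` by `leg23`. -/
theorem leg23_mul_leg12_mul_leg23 (R Q : A ⊗[k] A) (x y : Fin m → A) :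
    leg23 k A R * leg12 k A (∑ i, x i ⊗ₜ[k] y i) * leg23 k A Q
      = ∑ i, x i ⊗ₜ[k] (R * (y i ⊗ₜ 1) * Q) := by
  simp [map_sum, leg12_tmul, leg23_apply, Finset.mul_sum, Finset.sum_mul]

/-- Conjugation of `leg23` by `leg12`. -/
theorem leg12_mul_leg23_mul_leg12 (Q R : A ⊗[k] A) (x y : Fin m → A) :
    leg12 k A Q * leg23 k A (∑ i, x i ⊗ₜ[k] y i) * leg12 k A R
      = ∑ i, Algebra.TensorProduct.assoc k k k A A A ((Q * (1 ⊗ₜ x i) * R) ⊗ₜ y i) := by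
  have h : leg23 k A (∑ i, x i ⊗ₜ[k] y i)
      = ∑ i, Algebra.TensorProduct.assoc k k k A A A ((1 ⊗ₜ x i) ⊗ₜ y i) := by
    simp [leg23_apply]
  rw [h, leg12_eq_assoc, leg12_eq_assoc, Finset.mul_sum, Finset.sum_mul]
  simp only [← map_mul, Algebra.TensorProduct.tmul_mul_tmul, one_mul, mul_one]

/-- The left coefficients of `R` span a subalgebra, with the structure constants of the
comultiplication `b ↦ R(b ⊗ 1)R⁻¹` on right coefficients. -/
theorem exists_left_structure {R Q : A ⊗[k] A} {a b : Fin m → A} (hR : R = ∑ i, a i ⊗ₜ[k] b i)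
    {α β : Fin m → Module.Dual k A} (hα : ∀ i j, α i (a j) = if i = j then 1 else 0)
    (hβ : ∀ i j, β i (b j) = if i = j then 1 else 0) (hRQ : R * Q = 1) (hp : IsPentagon R) :
    ∃ μ : Fin m → Fin m → Fin m → k, (∀ i j, a i * a j = ∑ t, μ i j t • a t) ∧
      ∀ t, R * (b t ⊗ₜ 1) * Q = ∑ i, ∑ j, μ i j t • (b i ⊗ₜ[k] b j) := by
  have h : ∑ i, ∑ j, (a i * a j) ⊗ₜ[k] (b i ⊗ₜ[k] b j)
      = ∑ t, a t ⊗ₜ[k] (R * (b t ⊗ₜ 1) * Q) := by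
    rw [← leg23_mul_leg12_mul_leg23, ← hR, ← hp, mul_assoc, ← map_mul, hRQ, map_one, mul_one, hR]
    simp [leg12_tmul, leg13_tmul, Finset.mul_sum, Finset.sum_mul]
    rw [Finset.sum_comm]
  let f : Fin m → Fin m → A ⊗[k] A →ₗ[k] k := fun i j =>
    LinearMap.mul' k k ∘ₗ TensorProduct.map (β i) (β j)
  have hmul : ∀ i j, a i * a j = ∑ t, f i j (R * (b t ⊗ₜ 1) * Q) • a t := by
    intro i j
    have h' := congrArg (fun x => TensorProduct.rid k A ((f i j).lTensor A x)) h
    simpa [f, hβ, ite_smul] using h'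
  refine ⟨_, hmul, fun t => eq_of_sum_tmul_eq hα (x := fun t => R * (b t ⊗ₜ 1) * Q)
    (y := fun t => ∑ i, ∑ j, f i j (R * (b t ⊗ₜ 1) * Q) • (b i ⊗ₜ[k] b j)) (h.symm.trans ?_) t⟩
  simp only [hmul, TensorProduct.sum_tmul, TensorProduct.tmul_sum]
  simp only [← TensorProduct.smul_tmul', TensorProduct.tmul_smul]
  exact sum_rotate _

/-- The right coefficients of `R` span a subalgebra, with the structure constants of the
comultiplication `a ↦ R⁻¹(1 ⊗ a)R` on left coefficients. -/
theorem exists_right_structure {R Q : A ⊗[k] A} {a b : Fin m → A} (hR : R = ∑ i, a i ⊗ₜ[k] b i)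
    {α β : Fin m → Module.Dual k A} (hα : ∀ i j, α i (a j) = if i = j then 1 else 0)
    (hβ : ∀ i j, β i (b j) = if i = j then 1 else 0) (hQR : Q * R = 1) (hp : IsPentagon R) :
    ∃ ν : Fin m → Fin m → Fin m → k, (∀ i j, b i * b j = ∑ t, ν i j t • b t) ∧
      ∀ t, Q * (1 ⊗ₜ a t) * R = ∑ i, ∑ j, ν i j t • (a i ⊗ₜ[k] a j) := by
  have h : ∑ i, ∑ j, a i ⊗ₜ[k] (a j ⊗ₜ[k] (b i * b j))
      = ∑ t, Algebra.TensorProduct.assoc k k k A A A ((Q * (1 ⊗ₜ a t) * R) ⊗ₜ b t) := by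
    rw [← leg12_mul_leg23_mul_leg12, ← hR, mul_assoc, ← hp, ← mul_assoc, ← mul_assoc, ← map_mul,
      hQR, map_one, one_mul, hR]
    simp [leg23_apply, leg13_tmul, Finset.mul_sum, Finset.sum_mul]
    rw [Finset.sum_comm]
  let f : Fin m → Fin m → A ⊗[k] A →ₗ[k] k := fun i j =>
    LinearMap.mul' k k ∘ₗ TensorProduct.map (α i) (α j)
  have h2 : ∑ i, ∑ j, (a i ⊗ₜ[k] a j) ⊗ₜ[k] (b i * b j) = ∑ t, (Q * (1 ⊗ₜ a t) * R) ⊗ₜ b t := by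
    apply (Algebra.TensorProduct.assoc k k k A A A).injective
    simpa only [map_sum, Algebra.TensorProduct.assoc_tmul] using h
  have hmul : ∀ i j, b i * b j = ∑ t, f i j (Q * (1 ⊗ₜ a t) * R) • b t := by
    intro i j
    have h' := congrArg (fun x => TensorProduct.lid k A ((f i j).rTensor A x)) h2
    simpa [f, hα, ite_smul] using h'
  refine ⟨_, hmul, fun t => eq_of_sum_tmul_eq hβ (x := fun t => Q * (1 ⊗ₜ a t) * R)
    (y := fun t => ∑ i, ∑ j, f i j (Q * (1 ⊗ₜ a t) * R) • (a i ⊗ₜ[k] a j)) ?_ t⟩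
  apply (TensorProduct.comm k A (A ⊗[k] A)).injective
  simp only [map_sum, TensorProduct.comm_tmul]
  refine h2.symm.trans ?_
  simp only [hmul, TensorProduct.sum_tmul, TensorProduct.tmul_sum]
  simp only [← TensorProduct.smul_tmul', TensorProduct.tmul_smul]
  exact sum_rotate fun i j t => _

end StructureConstants

section Antipode

variable {k : Type*} [Field k] {A : Type*} [Ring A] [Algebra k A] {m : ℕ}

theorem one_tmul_injective {x y : A} (h : (1 : A) ⊗ₜ[k] x = 1 ⊗ₜ[k] y) : x = y := by
  nontriviality A
  exact Algebra.TensorProduct.includeRight_injective (FaithfulSMul.algebraMap_injective k A) h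

/-- The subspace of `A ⊗ A` spanned by the `p ⊗ h` with `p ∈ P` and `h ∈ H`. -/
def tensorSpan (P H : Submodule k A) : Submodule k (A ⊗[k] A) :=
  Submodule.span k {t | ∃ p ∈ P, ∃ h ∈ H, t = p ⊗ₜ[k] h}

theorem tmul_mem_tensorSpan {P H : Submodule k A} {p h : A} (hp : p ∈ P) (hh : h ∈ H) :
    p ⊗ₜ[k] h ∈ tensorSpan P H :=
  Submodule.subset_span ⟨p, hp, h, hh, rfl⟩

theorem mul_mem_tensorSpan {P H : Submodule k A} (hP : P * P ≤ P) (hH : H * H ≤ H)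
    {x y : A ⊗[k] A} (hx : x ∈ tensorSpan P H) (hy : y ∈ tensorSpan P H) :
    x * y ∈ tensorSpan P H := by
  refine (?_ : tensorSpan P H * tensorSpan P H ≤ tensorSpan P H) (Submodule.mul_mem_mul hx hy)
  rw [tensorSpan, Submodule.span_mul_span, Submodule.span_le]
  rintro _ ⟨_, ⟨p, hp, h, hh, rfl⟩, _, ⟨p', hp', h', hh', rfl⟩, rfl⟩
  exact Submodule.subset_span ⟨_, hP (Submodule.mul_mem_mul hp hp'), _,
    hH (Submodule.mul_mem_mul hh hh'), Algebra.TensorProduct.tmul_mul_tmul ..⟩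

/-- A unit of `A ⊗ A` lying in `P ⊗ H`, for subalgebras `P` and `H` not assumed to contain `1`,
has its inverse in `P ⊗ H`. -/
theorem one_mem_and_inv_mem_tensorSpan [FiniteDimensional k A] {P H : Submodule k A}
    (hP : P * P ≤ P) (hH : H * H ≤ H) {r q : A ⊗[k] A} (hr : r ∈ tensorSpan P H)
    (hrq : r * q = 1) (hqr : q * r = 1) : 1 ∈ tensorSpan P H ∧ q ∈ tensorSpan P H := by
  have hu : IsUnit r := ⟨⟨r, q, hrq, hqr⟩, rfl⟩
  have hN : ∀ x ∈ tensorSpan P H, r * x ∈ tensorSpan P H := fun x hx =>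
    mul_mem_tensorSpan hP hH hr hx
  have h1 : (1 : A ⊗[k] A) ∈ tensorSpan P H := by
    obtain ⟨x, hx, h⟩ := exists_mul_eq_of_isUnit hu hN hr
    rwa [hu.mul_left_cancel (h.trans (mul_one r).symm)] at hx
  refine ⟨h1, ?_⟩
  obtain ⟨x, hx, h⟩ := exists_mul_eq_of_isUnit hu hN h1
  rwa [hu.mul_left_cancel (h.trans hrq.symm)] at hx

theorem exists_eq_sum_of_mem_tensorSpan {a : Fin m → A} {H : Submodule k A} {x : A ⊗[k] A}
    (hx : x ∈ tensorSpan (Submodule.span k (Set.range a)) H) :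
    ∃ c : Fin m → A, (∀ i, c i ∈ H) ∧ x = ∑ i, a i ⊗ₜ[k] c i := by
  induction hx using Submodule.span_induction with
  | mem x hx =>
    obtain ⟨p, hp, h, hh, rfl⟩ := hx
    obtain ⟨l, rfl⟩ := (Submodule.mem_span_range_iff_exists_fun k).1 hp
    refine ⟨fun i => l i • h, fun i => H.smul_mem _ hh, ?_⟩
    simp [TensorProduct.sum_tmul, TensorProduct.smul_tmul]
  | zero => exact ⟨0, fun i => H.zero_mem, by simp⟩
  | add x y _ _ hx hy =>
    obtain ⟨c, hc, rfl⟩ := hx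
    obtain ⟨d, hd, rfl⟩ := hy
    exact ⟨fun i => c i + d i, fun i => H.add_mem (hc i) (hd i), by
      simp [TensorProduct.tmul_add, Finset.sum_add_distrib]⟩
  | smul l x _ hx =>
    obtain ⟨c, hc, rfl⟩ := hx
    exact ⟨fun i => l • c i, fun i => H.smul_mem _ (hc i), by
      simp [Finset.smul_sum]⟩

theorem exists_dual_one_eq_one [Nontrivial A] : ∃ ψ : Module.Dual k A, ψ 1 = 1 := by
  obtain ⟨φ, hφ⟩ := exists_dual_family (k := k) (a := fun _ : Fin 1 => (1 : A))
    (LinearIndependent.of_subsingleton 0 one_ne_zero)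
  exact ⟨φ 0, by simpa using hφ 0 0⟩

theorem one_mem_of_one_mem_tensorSpan {P H : Submodule k A} (h : 1 ∈ tensorSpan P H) :
    (1 : A) ∈ P ∧ (1 : A) ∈ H := by
  rcases subsingleton_or_nontrivial A with hA | hA
  · rw [Subsingleton.elim (1 : A) 0]
    exact ⟨P.zero_mem, H.zero_mem⟩
  obtain ⟨ψ, hψ⟩ := exists_dual_one_eq_one (k := k) (A := A)
  have key : ∀ x ∈ tensorSpan P H, TensorProduct.rid k A (ψ.lTensor A x) ∈ P ∧
      TensorProduct.lid k A (ψ.rTensor A x) ∈ H := by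
    intro x hx
    induction hx using Submodule.span_induction with
    | mem x hx =>
      obtain ⟨p, hp, h, hh, rfl⟩ := hx
      simpa using ⟨P.smul_mem _ hp, H.smul_mem _ hh⟩
    | zero => simp
    | add x y _ _ hx hy =>
      simpa using ⟨P.add_mem hx.1 hy.1, H.add_mem hx.2 hy.2⟩
    | smul l x _ hx =>
      simpa using ⟨P.smul_mem l hx.1, H.smul_mem l hx.2⟩
  simpa [Algebra.TensorProduct.one_def, hψ] using key 1 h

theorem span_mul_span_le {a : Fin m → A}
    (h : ∀ i j, a i * a j ∈ Submodule.span k (Set.range a)) :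
    Submodule.span k (Set.range a) * Submodule.span k (Set.range a)
      ≤ Submodule.span k (Set.range a) := by
  rw [Submodule.span_mul_span, Submodule.span_le]
  rintro _ ⟨_, ⟨i, rfl⟩, _, ⟨j, rfl⟩, rfl⟩
  exact h i j

theorem sum_smul_mem_span (l : Fin m → k) (a : Fin m → A) :
    ∑ t, l t • a t ∈ Submodule.span k (Set.range a) :=
  Submodule.sum_mem _ fun t _ => Submodule.smul_mem _ _ (Submodule.subset_span ⟨t, rfl⟩)

/-- The right coefficients of `R⁻¹` multiply in the opposite way to those of `R`. -/
theorem inv_coef_mul {R Q : A ⊗[k] A} {a c : Fin m → A}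
    (hQ : Q = ∑ i, a i ⊗ₜ[k] c i)
    {α : Fin m → Module.Dual k A} (hα : ∀ i j, α i (a j) = if i = j then 1 else 0)
    (hRQ : R * Q = 1) (hQR : Q * R = 1) (hp : IsPentagon R)
    {ν : Fin m → Fin m → Fin m → k}
    (hν : ∀ t, Q * (1 ⊗ₜ a t) * R = ∑ i, ∑ j, ν i j t • (a i ⊗ₜ[k] a j)) (i j : Fin m) :
    c j * c i = ∑ t, ν i j t • c t := by
  have h12 : leg12 k A Q * leg12 k A R = 1 := by rw [← map_mul, hQR, map_one]
  have h13 : leg13 k A R * leg13 k A Q = 1 := by rw [← map_mul, hRQ, map_one]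
  have h23 : leg23 k A R * leg23 k A Q = 1 := by rw [← map_mul, hRQ, map_one]
  have hp' : leg13 k A R * leg23 k A R = leg12 k A Q * (leg23 k A R * leg12 k A R) := by
    rw [← hp, ← mul_assoc, ← mul_assoc, h12, one_mul]
  have h1 : leg12 k A Q * leg23 k A Q * leg12 k A R = leg23 k A Q * leg13 k A Q := by
    have e1 : (leg12 k A Q * leg23 k A Q * leg12 k A R) * (leg13 k A R * leg23 k A R) = 1 := by
      have h12' : leg12 k A R * leg12 k A Q = 1 := by rw [← map_mul, hRQ, map_one]
      have h23' : leg23 k A Q * leg23 k A R = 1 := by rw [← map_mul, hQR, map_one]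
      rw [hp', mul_assoc, ← mul_assoc (leg12 k A R), h12', one_mul, mul_assoc,
        ← mul_assoc (leg23 k A Q), h23', one_mul, h12]
    have e2 : (leg13 k A R * leg23 k A R) * (leg23 k A Q * leg13 k A Q) = 1 := by
      rw [mul_assoc, ← mul_assoc (leg23 k A R), h23, one_mul, h13]
    exact left_inv_eq_right_inv e1 e2
  have h2 : ∑ t, Algebra.TensorProduct.assoc k k k A A A ((Q * (1 ⊗ₜ a t) * R) ⊗ₜ c t)
      = ∑ i, ∑ j, a i ⊗ₜ[k] (a j ⊗ₜ[k] (c j * c i)) := by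
    rw [← leg12_mul_leg23_mul_leg12, ← hQ, h1, hQ]
    simp [leg23_apply, leg13_tmul, Finset.mul_sum, Finset.sum_mul]
  simp only [hν, TensorProduct.sum_tmul, map_sum, ← TensorProduct.smul_tmul', map_smul,
    Algebra.TensorProduct.assoc_tmul] at h2
  rw [← sum_rotate fun i j t => ν i j t • (a i ⊗ₜ[k] (a j ⊗ₜ[k] c t))] at h2
  simp only [← TensorProduct.tmul_smul, ← TensorProduct.tmul_sum] at h2
  exact (eq_of_sum_tmul_eq hα (eq_of_sum_tmul_eq hα h2 i) j).symm

/-- The comultiplication `b ↦ R(b ⊗ 1)R⁻¹` of the right coefficients of `R⁻¹`. -/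
theorem inv_coef_comul {R Q : A ⊗[k] A} {a c : Fin m → A}
    (hQ : Q = ∑ i, a i ⊗ₜ[k] c i)
    {α : Fin m → Module.Dual k A} (hα : ∀ i j, α i (a j) = if i = j then 1 else 0)
    (hRQ : R * Q = 1) (hQR : Q * R = 1) (hp : IsPentagon R)
    {μ : Fin m → Fin m → Fin m → k} (hμ : ∀ i j, a i * a j = ∑ t, μ i j t • a t) (t : Fin m) :
    R * (c t ⊗ₜ 1) * Q = ∑ i, ∑ j, μ i j t • (c j ⊗ₜ[k] c i) := by
  have h12 : leg12 k A R * leg12 k A Q = 1 := by rw [← map_mul, hRQ, map_one]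
  have h13 : leg13 k A R * leg13 k A Q = 1 := by rw [← map_mul, hRQ, map_one]
  have h23 : leg23 k A R * leg23 k A Q = 1 := by rw [← map_mul, hRQ, map_one]
  have hp' : leg12 k A R * leg13 k A R = leg23 k A R * leg12 k A R * leg23 k A Q := by
    rw [← hp, mul_assoc _ (leg23 k A R), h23, mul_one]
  have h1 : leg23 k A R * leg12 k A Q * leg23 k A Q = leg13 k A Q * leg12 k A Q := by
    have e1 : (leg23 k A R * leg12 k A Q * leg23 k A Q) * (leg12 k A R * leg13 k A R) = 1 := by
      have h12' : leg12 k A Q * leg12 k A R = 1 := by rw [← map_mul, hQR, map_one]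
      have h23' : leg23 k A Q * leg23 k A R = 1 := by rw [← map_mul, hQR, map_one]
      rw [hp', mul_assoc, mul_assoc (leg23 k A R) (leg12 k A R), ← mul_assoc (leg23 k A Q), h23',
        one_mul, mul_assoc, ← mul_assoc (leg12 k A Q), h12', one_mul, h23]
    have e2 : (leg12 k A R * leg13 k A R) * (leg13 k A Q * leg12 k A Q) = 1 := by
      rw [mul_assoc, ← mul_assoc (leg13 k A R), h13, one_mul, h12]
    exact left_inv_eq_right_inv e1 e2
  have h2 : ∑ t, a t ⊗ₜ[k] (R * (c t ⊗ₜ 1) * Q)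
      = ∑ i, ∑ j, (a i * a j) ⊗ₜ[k] (c j ⊗ₜ[k] c i) := by
    rw [← leg23_mul_leg12_mul_leg23, ← hQ, h1, hQ]
    simp [leg12_tmul, leg13_tmul, Finset.mul_sum, Finset.sum_mul]
    rw [Finset.sum_comm]
  simp only [hμ, TensorProduct.sum_tmul] at h2
  rw [sum_rotate fun i j t => (μ i j t • a t) ⊗ₜ[k] (c j ⊗ₜ[k] c i)] at h2
  simp only [TensorProduct.smul_tmul, ← TensorProduct.tmul_sum] at h2
  simpa using eq_of_sum_tmul_eq hα h2 t

end Antipode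

section TwistedAntipode

variable {k : Type*} [Field k] {A : Type*} [Ring A] [Algebra k A] {m : ℕ}

/-- The antipode `bᵢ ↦ cᵢ`, where `R⁻¹ = ∑ aᵢ ⊗ cᵢ`, is bijective on right coefficients: its
inverse `T` is again an anti-homomorphism. -/
theorem exists_inverse_antipode [FiniteDimensional k A] {R Q : A ⊗[k] A} {a b c : Fin m → A}
    (hR : R = ∑ i, a i ⊗ₜ[k] b i) (hQ : Q = ∑ i, a i ⊗ₜ[k] c i) (hb : LinearIndependent k b)
    {α : Fin m → Module.Dual k A} (hα : ∀ i j, α i (a j) = if i = j then 1 else 0)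
    (hRQ : R * Q = 1) (hQR : Q * R = 1)
    {μ ν : Fin m → Fin m → Fin m → k} (hμ : ∀ i j, a i * a j = ∑ t, μ i j t • a t)
    (hν : ∀ i j, b i * b j = ∑ t, ν i j t • b t)
    (hc : ∀ i j, c j * c i = ∑ t, ν i j t • c t) :
    ∃ T : A →ₗ[k] A, T 1 = 1 ∧ (∀ i, T (c i) = b i) ∧
      (∀ i, b i ∈ Submodule.span k (Set.range c)) ∧
      ∀ x ∈ Submodule.span k (Set.range c), ∀ y ∈ Submodule.span k (Set.range c),
        T (x * y) = T y * T x := by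
  have hP := span_mul_span_le (k := k) (a := a) fun i j => by
    rw [hμ]; exact sum_smul_mem_span _ _
  have hC := span_mul_span_le (k := k) (a := c) fun i j => by
    rw [hc]; exact sum_smul_mem_span _ _
  have hQC : Q ∈ tensorSpan (Submodule.span k (Set.range a)) (Submodule.span k (Set.range c)) := by
    rw [hQ]
    exact Submodule.sum_mem _ fun i _ => tmul_mem_tensorSpan (Submodule.subset_span ⟨i, rfl⟩)
      (Submodule.subset_span ⟨i, rfl⟩)
  obtain ⟨h1, hRC⟩ := one_mem_and_inv_mem_tensorSpan hP hC hQC hQR hRQ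
  have h1C := (one_mem_of_one_mem_tensorSpan h1).2
  have hbC : ∀ i, b i ∈ Submodule.span k (Set.range c) := by
    obtain ⟨b', hb', h⟩ := exists_eq_sum_of_mem_tensorSpan hRC
    intro i
    rw [eq_of_sum_tmul_eq hα (hR.symm.trans h) i]
    exact hb' i
  have hcli : LinearIndependent k c := by
    rw [linearIndependent_iff_card_le_finrank_span] at hb ⊢
    exact hb.trans (Submodule.finrank_mono (Submodule.span_le.2 (Set.range_subset_iff.2 hbC)))
  obtain ⟨γ, hγ⟩ := exists_dual_family hcli
  let T : A →ₗ[k] A := ∑ i, (γ i).smulRight (b i)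
  have hT : ∀ i, T (c i) = b i := by
    intro i
    simp [T, hγ, ite_smul]
  have hTmul : ∀ x ∈ Submodule.span k (Set.range c), ∀ y ∈ Submodule.span k (Set.range c),
      T (x * y) = T y * T x := by
    intro x hx y hy
    induction hx, hy using Submodule.span_induction₂ with
    | mem_mem x y hx hy =>
      obtain ⟨i, rfl⟩ := hx
      obtain ⟨j, rfl⟩ := hy
      simp [hc, hT, hν]
    | zero_left y hy => simp
    | zero_right x hx => simp
    | add_left x y z _ _ _ h1 h2 => simp [add_mul, mul_add, h1, h2]
    | add_right x y z _ _ _ h1 h2 => simp [add_mul, mul_add, h1, h2]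
    | smul_left r x y _ _ h => simp [h]
    | smul_right r x y _ _ h => simp [h]
  refine ⟨T, one_tmul_injective (k := k) ?_, hT, hbC, hTmul⟩
  have h : (1 : A) ⊗ₜ[k] T 1 * R = R := by
    simp only [hR, Finset.mul_sum, Algebra.TensorProduct.tmul_mul_tmul, one_mul]
    refine Finset.sum_congr rfl fun i _ => ?_
    rw [← hT i, ← hTmul _ (Submodule.subset_span ⟨i, rfl⟩) _ h1C, mul_one]
  have h' := congrArg (· * Q) h
  simp only [mul_assoc, hRQ, mul_one] at h'
  exact h'.trans Algebra.TensorProduct.one_def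

/-- The matrix units `bᵢ g aⱼ` attached to an invertible solution of the pentagon equation. -/
theorem exists_matrixUnits [FiniteDimensional k A] {R Q : A ⊗[k] A} {a b : Fin m → A}
    (hR : R = ∑ i, a i ⊗ₜ[k] b i) (ha : LinearIndependent k a) (hb : LinearIndependent k b)
    (hRQ : R * Q = 1) (hQR : Q * R = 1) (hp : IsPentagon R) :
    ∃ e : Fin m → Fin m → A,
      (∀ i j p q, e i j * e p q = if j = p then e i q else 0) ∧ ∑ i, e i i = 1 := by
  obtain ⟨α, hα⟩ := exists_dual_family ha
  obtain ⟨β, hβ⟩ := exists_dual_family hb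
  obtain ⟨μ, hμ, hΔb⟩ := exists_left_structure hR hα hβ hRQ hp
  obtain ⟨ν, hν, hΔa⟩ := exists_right_structure hR hα hβ hQR hp
  have hP := span_mul_span_le (k := k) (a := a) fun i j => by
    rw [hμ]; exact sum_smul_mem_span _ _
  have hH := span_mul_span_le (k := k) (a := b) fun i j => by
    rw [hν]; exact sum_smul_mem_span _ _
  have hRN : R ∈ tensorSpan (Submodule.span k (Set.range a)) (Submodule.span k (Set.range b)) := by
    rw [hR]
    exact Submodule.sum_mem _ fun i _ => tmul_mem_tensorSpan (Submodule.subset_span ⟨i, rfl⟩)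
      (Submodule.subset_span ⟨i, rfl⟩)
  obtain ⟨h1, hQN⟩ := one_mem_and_inv_mem_tensorSpan hP hH hRN hRQ hQR
  obtain ⟨ε, hε⟩ := (Submodule.mem_span_range_iff_exists_fun k).1
    (one_mem_of_one_mem_tensorSpan h1).1
  obtain ⟨c, -, hQ⟩ := exists_eq_sum_of_mem_tensorSpan hQN
  have hc := inv_coef_mul hQ hα hRQ hQR hp hΔa
  have hΔc := inv_coef_comul hQ hα hRQ hQR hp hμ
  obtain ⟨T, hT1, hTc, hbC, hTmul⟩ :=
    exists_inverse_antipode hR hQ hb hα hRQ hQR hμ hν hc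
  have hcC : ∀ i, c i ∈ Submodule.span k (Set.range c) := fun i =>
    Submodule.subset_span ⟨i, rfl⟩
  -- `∑ aᵢ ⊗ T bᵢ` is inverse to `R` in `A ⊗ Aᵒᵖ`.
  have hU1 : ∑ i, ∑ j, (a i * a j) ⊗ₜ[k] (T (b j) * b i) = 1 := by
    have h : ∑ i, ∑ j, (a i * a j) ⊗ₜ[k] (c i * b j) = 1 := by
      rw [← hQR, hQ, hR]
      simp only [Finset.sum_mul, Finset.mul_sum, Algebra.TensorProduct.tmul_mul_tmul]
      rw [Finset.sum_comm]
    have h' := congrArg (T.lTensor A) h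
    simpa [hTmul, hcC, hbC, hTc, Algebra.TensorProduct.one_def, hT1] using h'
  have hU2 : ∑ i, ∑ j, (a i * a j) ⊗ₜ[k] (b j * T (b i)) = 1 := by
    have h : ∑ i, ∑ j, (a i * a j) ⊗ₜ[k] (b i * c j) = 1 := by
      rw [← hRQ, hQ, hR]
      simp only [Finset.sum_mul, Finset.mul_sum, Algebra.TensorProduct.tmul_mul_tmul]
      rw [Finset.sum_comm]
    have h' := congrArg (T.lTensor A) h
    simpa [hTmul, hcC, hbC, hTc, Algebra.TensorProduct.one_def, hT1] using h'
  have hΔd : ∀ t, R * (T (b t) ⊗ₜ 1) * Q = ∑ i, ∑ j, μ i j t • (T (b j) ⊗ₜ[k] T (b i)) := by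
    let δ : A →ₗ[k] A ⊗[k] A := LinearMap.mulRight k Q ∘ₗ LinearMap.mulLeft k R ∘ₗ
      (TensorProduct.mk k A A).flip 1
    have hδ : ∀ x, δ x = R * (x ⊗ₜ 1) * Q := fun x => rfl
    have key : ∀ x ∈ Submodule.span k (Set.range c),
        TensorProduct.map T T (δ x) = TensorProduct.comm k A A (δ (T x)) := by
      intro x hx
      induction hx using Submodule.span_induction with
      | mem x hx =>
        obtain ⟨t, rfl⟩ := hx
        rw [hTc, hδ, hδ, hΔc, hΔb]
        simp [hTc]
      | zero => simp
      | add x y _ _ hx hy => simp only [map_add, hx, hy]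
      | smul l x _ hx => simp only [map_smul, hx]
    intro t
    apply (TensorProduct.comm k A A).injective
    rw [← hδ, ← key _ (hbC t), hδ, hΔb]
    simp
  set g : A := ∑ i, T (b i) * a i with hg
  -- `g` is an `R`-coinvariant
  have hRg : R * (g ⊗ₜ 1) = g ⊗ₜ 1 := by
    have h : ∀ i, R * ((T (b i) * a i) ⊗ₜ 1) = ∑ p, ∑ q,
        (T (b q) ⊗ₜ[k] T (b p)) * (R * ((μ p q i • a i) ⊗ₜ 1)) := by
      intro i
      have h' : R * ((T (b i) * a i) ⊗ₜ 1) = (R * (T (b i) ⊗ₜ 1) * Q) * (R * (a i ⊗ₜ 1)) := by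
        rw [mul_assoc, ← mul_assoc Q, hQR, one_mul, mul_assoc]
        simp
      rw [h', hΔd]
      simp only [Finset.sum_mul, smul_mul_assoc, ← TensorProduct.smul_tmul', mul_smul_comm]
    have h2 : ∀ q, ∑ p, (T (b q) ⊗ₜ[k] T (b p)) * (R * ((a p * a q) ⊗ₜ 1))
        = (T (b q) * a q) ⊗ₜ 1 := by
      intro q
      have h' := congrArg (fun x => (T (b q) ⊗ₜ[k] (1 : A)) * x * (a q ⊗ₜ[k] (1 : A))) hU1
      simp only [mul_one, Algebra.TensorProduct.tmul_mul_tmul, Finset.mul_sum, Finset.sum_mul,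
        one_mul] at h'
      rw [← h', Finset.sum_comm]
      simp only [hR, Finset.sum_mul, Finset.mul_sum, Algebra.TensorProduct.tmul_mul_tmul, mul_one,
        mul_assoc]
    calc R * (g ⊗ₜ 1) = ∑ i, ∑ p, ∑ q, (T (b q) ⊗ₜ[k] T (b p)) * (R * ((μ p q i • a i) ⊗ₜ 1)) := by
          simp only [hg, TensorProduct.sum_tmul, Finset.mul_sum, h]
      _ = ∑ p, ∑ q, (T (b q) ⊗ₜ[k] T (b p)) * (R * ((a p * a q) ⊗ₜ 1)) := by
          rw [← sum_rotate fun p q i => (T (b q) ⊗ₜ[k] T (b p)) * (R * ((μ p q i • a i) ⊗ₜ 1))]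
          simp only [hμ, TensorProduct.sum_tmul, Finset.mul_sum]
      _ = g ⊗ₜ 1 := by
          rw [Finset.sum_comm]
          simp only [h2, hg, TensorProduct.sum_tmul]
  have hTb : ∀ t, ∑ i, ∑ j, μ i j t • (T (b j) * b i) = ε t • (1 : A) := by
    refine eq_of_sum_tmul_eq hα (x := fun t => ∑ i, ∑ j, μ i j t • (T (b j) * b i))
      (y := fun t => ε t • (1 : A)) ?_
    have h : ∑ t, a t ⊗ₜ[k] (ε t • (1 : A)) = 1 := by
      simp only [← TensorProduct.smul_tmul, ← TensorProduct.sum_tmul, hε,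
        Algebra.TensorProduct.one_def]
    rw [h, ← hU1]
    simp only [hμ, TensorProduct.sum_tmul]
    rw [sum_rotate fun i j t => (μ i j t • a t) ⊗ₜ[k] (T (b j) * b i)]
    simp only [TensorProduct.tmul_sum, TensorProduct.smul_tmul]
  have hgb : ∀ t, g * b t = ε t • g := by
    intro t
    have h : R * (b t ⊗ₜ 1) = (∑ i, ∑ j, μ i j t • (b i ⊗ₜ[k] b j)) * R := by
      rw [← hΔb, mul_assoc, hQR, mul_one]
    have h' := congrArg (fun x => LinearMap.mul' k A (TensorProduct.comm k A A (T.lTensor A x))) h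
    rw [hR] at h'
    simp only [Finset.sum_mul, Finset.mul_sum, smul_mul_assoc, map_sum, map_smul,
      Algebra.TensorProduct.tmul_mul_tmul, mul_one, LinearMap.lTensor_tmul,
      TensorProduct.comm_tmul, LinearMap.mul'_apply, hTmul _ (hbC _) _ (hbC _)] at h'
    calc g * b t = ∑ s, T (b s) * (∑ i, ∑ j, μ i j t • (T (b j) * b i)) * a s := by
          simp only [hg, Finset.sum_mul, mul_assoc, h', Finset.mul_sum, mul_smul_comm,
            smul_mul_assoc]
      _ = ε t • g := by
          simp only [hTb, hg, mul_smul_comm, mul_one, smul_mul_assoc, Finset.smul_sum]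
  have hsum : ∑ i, b i * g * a i = 1 := by
    have h := congrArg (LinearMap.mul' k A ∘ₗ (TensorProduct.comm k A A).toLinearMap) hU2
    simp only [map_sum, Algebra.TensorProduct.one_def] at h
    simp [hg, Finset.mul_sum, Finset.sum_mul, ← mul_assoc] at h ⊢
    rw [Finset.sum_comm]
    exact h
  have hgg : g * g = g := by
    have h : g * ∑ i, b i * g * a i = g * g := by
      simp only [Finset.mul_sum, ← mul_assoc, hgb, smul_mul_assoc]
      simp only [← mul_smul_comm, ← Finset.mul_sum, hε, mul_one]
    rw [← h, hsum, mul_one]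
  have hεμ : ∀ t j, ∑ i, μ i j t * ε i = if j = t then 1 else 0 := by
    intro t j
    have h : ∑ i, ε i • (a i * a j) = a j := by
      simp only [← smul_mul_assoc, ← Finset.sum_mul, hε, one_mul]
    have h' := congrArg (α t) h
    simpa [hμ, hα, mul_comm, eq_comm] using h'
  have hgabg : ∀ j t, g * a j * b t * g = if j = t then g else 0 := by
    intro j t
    have h : (g ⊗ₜ[k] (1 : A)) * (R * (b t ⊗ₜ 1) * Q) * (R * (g ⊗ₜ 1))
        = (g ⊗ₜ 1) * (R * (b t ⊗ₜ 1)) * (g ⊗ₜ 1) := by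
      simp only [mul_assoc]
      rw [← mul_assoc Q, hQR, one_mul]
    rw [hRg, hΔb, hR] at h
    have h' := congrArg (fun x => TensorProduct.rid k A ((β j).lTensor A x)) h
    simp only [Finset.mul_sum, Finset.sum_mul, mul_smul_comm, smul_mul_assoc,
      Algebra.TensorProduct.tmul_mul_tmul, one_mul, mul_one, hgb, hgg, map_sum,
      map_smul, LinearMap.lTensor_tmul, TensorProduct.rid_tmul, hβ, ite_smul, one_smul, zero_smul,
      smul_ite, smul_zero, Finset.sum_ite_eq, Finset.mem_univ, if_true] at h'
    rw [← mul_assoc] at h'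
    simp only [smul_smul, ← Finset.sum_smul, hεμ] at h'
    rw [← h']
    simp
  refine ⟨fun i j => b i * g * a j, fun i j p q => ?_, hsum⟩
  have h : b i * g * a j * (b p * g * a q) = b i * (g * a j * b p * g) * a q := by
    simp only [mul_assoc]
  rw [h, hgabg]
  split_ifs <;> simp

end TwistedAntipode

/-- **Statement 15.** If `A` is a finite-dimensional algebra and `R ∈ A ⊗ A` is an invertible
solution of the pentagon equation with `m = l(R)`, then there is an injective unital algebra
map `M_m(k) → A`; consequently `A ≅ M_m(B)` where `B` is the centralizer of its image, and in
particular `l(R)²` divides `dim_k A`. -/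
theorem matrix_embedding_of_pentagon
    {k : Type u} [Field k] {A : Type v} [Ring A] [Algebra k A] [FiniteDimensional k A]
    (R : A ⊗[k] A) (hinv : IsUnit R) (hpent : IsPentagon R) :
    ∃ F : Matrix (Fin (length R)) (Fin (length R)) k →ₐ[k] A,
      Function.Injective F ∧
      Nonempty (A ≃ₐ[k] Matrix (Fin (length R)) (Fin (length R))
        ↥(Subalgebra.centralizer k (Set.range F))) ∧
      (length R) ^ 2 ∣ Module.finrank k A := by
  obtain ⟨⟨r, q, hrq, hqr⟩, rfl⟩ := hinv
  obtain ⟨a, b, hR, ha, hb⟩ := exists_decomposition (k := k) r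
  obtain ⟨e, hmul, hone⟩ := exists_matrixUnits (k := k) hR ha hb hrq hqr hpent
  obtain ⟨F, -⟩ := exists_algHom_of_matrixUnits (k := k) e hmul hone
  obtain ⟨E⟩ := nonempty_algEquiv_matrix_centralizer F
  refine ⟨F, ?_, ⟨E⟩, ?_⟩
  · rcases isEmpty_or_nonempty (Fin (length r)) with hm | ⟨⟨i⟩⟩
    · exact Function.injective_of_subsingleton F
    · have : Nonempty (Fin (length r)) := ⟨i⟩
      have : Nontrivial A := ⟨a i, 0, ha.ne_zero i⟩
      exact RingHom.injective (F : Matrix (Fin (length r)) (Fin (length r)) k →+* A)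
  · rw [LinearEquiv.finrank_eq E.toLinearEquiv, Module.finrank_matrix, Fintype.card_fin, ← sq]
    exact Dvd.intro _ rfl

end PentagonPaper
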